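/- arXiv:2203.07513 — 6 statements merged into one kernel-verified Lean document; each statement's English description precedes it below -/
import Mathlib

section
/- Consider a single-stage screening process: a finite nonempty set of groups 𝒳, weights q_X > 0 and u_X > 0, and a minimally effective test τ_X = (τ_{X1}, τ_{X0}) for each X ∈ 𝒳. Let {π_X}_{X∈𝒳} be any policy satisfying Equal Opportunity, i.e., there is M with M(τ_X, π_X) = M for all X ∈ 𝒳, and suppose Σ_X q_X M(τ_X,π_X) + Σ_X u_X N(τ_X,π_X) > 0. Then the precision Σ_X q_X M(τ_X,π_X) / (Σ_X q_X M(τ_X,π_X) + Σ_X u_X N(τ_X,π_X)) is at most (Σ_X q_X) / (Σ_X (q_X + u_X·τ_{X0}/τ_{X1})). -/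
open Finset

noncomputable def Mval (t p : ℝ × ℝ) : ℝ := t.1 * p.1 + (1 - t.1) * p.2
noncomputable def Nval (t p : ℝ × ℝ) : ℝ := t.2 * p.1 + (1 - t.2) * p.2

/-- The pass rate of the unqualified is at least `t.2 / t.1` times that of the qualified. -/
lemma ratio_mul_Mval_le_Nval {t p : ℝ × ℝ} (h0 : 0 ≤ t.2) (h : t.2 < t.1) (hp : 0 ≤ p.2) :
    t.2 / t.1 * Mval t p ≤ Nval t p := by
  have ht : 0 < t.1 := h0.trans_lt h
  rw [div_mul_eq_mul_div, div_le_iff₀ ht, Mval, Nval]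
  linarith [mul_nonneg (sub_nonneg.2 h.le) hp]

/-- The precision of any Equal Opportunity policy for a single-stage screening process is at
most `(Σ q_X) / (Σ (q_X + u_X·τ_{X0}/τ_{X1}))`. -/
theorem stmt1 {𝒳 : Type*} [Fintype 𝒳] [Nonempty 𝒳]
    (q u : 𝒳 → ℝ) (τ π : 𝒳 → ℝ × ℝ)
    (hq : ∀ x, 0 < q x) (hu : ∀ x, 0 < u x)
    (hτ : ∀ x, (τ x).2 < (τ x).1 ∧ 0 ≤ (τ x).2 ∧ (τ x).1 ≤ 1)
    (hπ : ∀ x, (π x).1 ∈ Set.Icc (0:ℝ) 1 ∧ (π x).2 ∈ Set.Icc (0:ℝ) 1)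
    (M : ℝ) (hEO : ∀ x, Mval (τ x) (π x) = M)
    (hden : 0 < (∑ x, q x * Mval (τ x) (π x)) + ∑ x, u x * Nval (τ x) (π x)) :
    (∑ x, q x * Mval (τ x) (π x)) /
        ((∑ x, q x * Mval (τ x) (π x)) + ∑ x, u x * Nval (τ x) (π x)) ≤
      (∑ x, q x) / (∑ x, (q x + u x * ((τ x).2 / (τ x).1))) := by
  have hM : ∑ x, q x * Mval (τ x) (π x) = (∑ x, q x) * M := by
    simp only [hEO, Finset.sum_mul]
  have hQ : 0 < ∑ x, q x := Finset.sum_pos (fun x _ => hq x) Finset.univ_nonempty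
  have hS : 0 ≤ ∑ x, u x * ((τ x).2 / (τ x).1) :=
    Finset.sum_nonneg fun x _ => mul_nonneg (hu x).le
      (div_nonneg (hτ x).2.1 ((hτ x).2.1.trans (hτ x).1.le))
  have hN : (∑ x, u x * ((τ x).2 / (τ x).1)) * M ≤ ∑ x, u x * Nval (τ x) (π x) := by
    rw [Finset.sum_mul]
    refine Finset.sum_le_sum fun x _ => ?_
    rw [mul_assoc, ← hEO x]
    exact mul_le_mul_of_nonneg_left
      (ratio_mul_Mval_le_Nval (hτ x).2.1 (hτ x).1 (hπ x).2.1) (hu x).le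
  rw [Finset.sum_add_distrib, div_le_div_iff₀ hden (by linarith), hM]
  linarith [mul_le_mul_of_nonneg_left hN hQ.le]
end

section
/- Consider a k-stage screening process with minimally effective tests. Let π be any policy satisfying Equal Opportunity with Σ_X q_X M_X(π) + Σ_X u_X N_X(π) > 0. Then precision(π) ≤ ‖q‖₁ / (‖q‖₁ + Σ_{X∈𝒳} u_X · ∏_{i=1}^k (τ^i_{X0}/τ^i_{X1})). -/
open Finset

/-- True positive rate of group `x` through a `k`-stage pipeline. -/
noncomputable def MX {𝒳 : Type*} {k : ℕ} (τ π : 𝒳 → Fin k → ℝ × ℝ) (x : 𝒳) : ℝ :=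
  ∏ i, Mval (τ x i) (π x i)

/-- False positive rate of group `x` through a `k`-stage pipeline. -/
noncomputable def NX {𝒳 : Type*} {k : ℕ} (τ π : 𝒳 → Fin k → ℝ × ℝ) (x : 𝒳) : ℝ :=
  ∏ i, Nval (τ x i) (π x i)

/-- Precision (interview efficiency) of a policy. -/
noncomputable def prec {𝒳 : Type*} [Fintype 𝒳] {k : ℕ} (q u : 𝒳 → ℝ)
    (τ π : 𝒳 → Fin k → ℝ × ℝ) : ℝ :=
  (∑ x, q x * MX τ π x) / ((∑ x, q x * MX τ π x) + ∑ x, u x * NX τ π x)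

/-- A policy has all its entries in `[0,1]`. -/
def IsPolicy {𝒳 : Type*} {k : ℕ} (π : 𝒳 → Fin k → ℝ × ℝ) : Prop :=
  ∀ x i, (π x i).1 ∈ Set.Icc (0:ℝ) 1 ∧ (π x i).2 ∈ Set.Icc (0:ℝ) 1

/-- All tests are minimally effective: `τ₁ > τ₀ ≥ 0` (and lie in `[0,1]²`). -/
def MinEff {𝒳 : Type*} {k : ℕ} (τ : 𝒳 → Fin k → ℝ × ℝ) : Prop :=
  ∀ x i, (τ x i).2 < (τ x i).1 ∧ 0 ≤ (τ x i).2 ∧ (τ x i).1 ≤ 1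

lemma Mval_nonneg {t p : ℝ × ℝ} (ht : 0 ≤ t.1) (ht' : t.1 ≤ 1) (hp₁ : 0 ≤ p.1)
    (hp₀ : 0 ≤ p.2) : 0 ≤ Mval t p :=
  add_nonneg (mul_nonneg ht hp₁) (mul_nonneg (sub_nonneg.2 ht') hp₀)

lemma div_mul_Mval_le_Nval {t p : ℝ × ℝ} (ht : 0 < t.1) (ht' : t.2 ≤ t.1) (hp : 0 ≤ p.2) :
    t.2 / t.1 * Mval t p ≤ Nval t p := by
  have hcancel : t.2 / t.1 * t.1 = t.2 := div_mul_cancel₀ _ ht.ne'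
  have hdiff : Nval t p - t.2 / t.1 * Mval t p = (1 - t.2 / t.1) * p.2 := by
    unfold Mval Nval
    linear_combination (p.2 - p.1) * hcancel
  have hnonneg : 0 ≤ (1 - t.2 / t.1) * p.2 :=
    mul_nonneg (sub_nonneg.2 (div_le_one_of_le₀ ht' ht.le)) hp
  linarith

lemma MinEff.pos {𝒳 : Type*} {k : ℕ} {τ : 𝒳 → Fin k → ℝ × ℝ} (hτ : MinEff τ) (x : 𝒳)
    (i : Fin k) : 0 < (τ x i).1 :=
  (hτ x i).2.1.trans_lt (hτ x i).1

lemma MinEff.Mval_nonneg {𝒳 : Type*} {k : ℕ} {τ π : 𝒳 → Fin k → ℝ × ℝ} (hτ : MinEff τ)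
    (hπ : IsPolicy π) (x : 𝒳) (i : Fin k) : 0 ≤ Mval (τ x i) (π x i) :=
  _root_.Mval_nonneg (hτ.pos x i).le (hτ x i).2.2 (hπ x i).1.1 (hπ x i).2.1

lemma MinEff.prod_div_mul_MX_le_NX {𝒳 : Type*} {k : ℕ} {τ π : 𝒳 → Fin k → ℝ × ℝ}
    (hτ : MinEff τ) (hπ : IsPolicy π) (x : 𝒳) :
    (∏ i, (τ x i).2 / (τ x i).1) * MX τ π x ≤ NX τ π x := by
  unfold MX NX
  rw [← prod_mul_distrib]
  exact prod_le_prod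
    (fun i _ => mul_nonneg (div_nonneg (hτ x i).2.1 (hτ.pos x i).le) (hτ.Mval_nonneg hπ x i))
    (fun i _ => div_mul_Mval_le_Nval (hτ.pos x i) (hτ x i).1.le (hπ x i).2.1)

/-- The precision of any Equal Opportunity policy for a `k`-stage screening process with
minimally effective tests is at most
`‖q‖₁ / (‖q‖₁ + Σ_X u_X ∏_i (τ^i_{X0}/τ^i_{X1}))`. -/
theorem stmt3 {𝒳 : Type*} [Fintype 𝒳] [Nonempty 𝒳] {k : ℕ}
    (q u : 𝒳 → ℝ) (τ π : 𝒳 → Fin k → ℝ × ℝ)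
    (hq : ∀ x, 0 < q x) (hu : ∀ x, 0 < u x)
    (hτ : MinEff τ) (hπ : IsPolicy π)
    (M : ℝ) (hEO : ∀ x, MX τ π x = M)
    (hden : 0 < (∑ x, q x * MX τ π x) + ∑ x, u x * NX τ π x) :
    prec q u τ π ≤
      (∑ x, q x) / ((∑ x, q x) + ∑ x, u x * ∏ i, (τ x i).2 / (τ x i).1) := by
  have hQ : 0 < ∑ x, q x := sum_pos (fun x _ => hq x) univ_nonempty
  have hR : 0 ≤ ∑ x, u x * ∏ i, (τ x i).2 / (τ x i).1 :=
    sum_nonneg fun x _ => mul_nonneg (hu x).le <|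
      prod_nonneg fun i _ => div_nonneg (hτ x i).2.1 (hτ.pos x i).le
  have hN : (∑ x, u x * ∏ i, (τ x i).2 / (τ x i).1) * M ≤ ∑ x, u x * NX τ π x := by
    rw [sum_mul]
    refine sum_le_sum fun x _ => ?_
    rw [mul_assoc, ← hEO x]
    exact mul_le_mul_of_nonneg_left (hτ.prod_div_mul_MX_le_NX hπ x) (hu x).le
  have hM : ∑ x, q x * MX τ π x = (∑ x, q x) * M := by simp only [hEO, sum_mul]
  unfold prec
  rw [hM] at hden ⊢
  rw [div_le_div_iff₀ hden (by positivity), mul_assoc]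
  refine mul_le_mul_of_nonneg_left ?_ hQ.le
  linarith
end

section
/- Consider a k-stage screening process with minimally effective tests and let π be any Equal Opportunity policy with recall(π) > 0. Then there exists an Equal Opportunity policy π' satisfying (1 − π'^i_{X1})·π'^i_{X0} = 0 for every group X ∈ 𝒳 and every stage i ∈ {1,…,k}, with recall(π') ≥ recall(π) and precision(π') ≥ precision(π). (Any Equal Opportunity policy is weakly Pareto dominated, with respect to recall and precision, by an Equal Opportunity policy in which at each stage and group either everyone who passes is promoted or no one who fails is promoted.) -/
open Finset

/-- The promotion probability of a negative example is nonnegative. -/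
theorem Nval_nonneg {t p : ℝ × ℝ} (h0 : 0 ≤ t.2) (h1 : t.2 ≤ 1) (hp₁ : 0 ≤ p.1) (hp₀ : 0 ≤ p.2) :
    0 ≤ Nval t p :=
  add_nonneg (mul_nonneg h0 hp₁) (mul_nonneg (sub_nonneg.2 h1) hp₀)

/-- For a single test, any promotion rule can be replaced by one that promotes everyone who passes
or no one who fails, with the same `Mval` and no larger `Nval`. -/
theorem exists_extremal_rule {t p : ℝ × ℝ} (ht : t.2 < t.1) (h0 : 0 ≤ t.2) (h1 : t.1 ≤ 1)
    (hp₁ : p.1 ∈ Set.Icc (0 : ℝ) 1) (hp₀ : p.2 ∈ Set.Icc (0 : ℝ) 1) :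
    ∃ p' : ℝ × ℝ, p'.1 ∈ Set.Icc (0 : ℝ) 1 ∧ p'.2 ∈ Set.Icc (0 : ℝ) 1 ∧
      (1 - p'.1) * p'.2 = 0 ∧ Mval t p' = Mval t p ∧ Nval t p' ≤ Nval t p := by
  obtain ⟨a, b⟩ := t
  obtain ⟨x, y⟩ := p
  obtain ⟨hx0, hx1⟩ := hp₁
  obtain ⟨hy0, hy1⟩ := hp₀
  simp only [Mval, Nval] at *
  have ha : 0 < a := h0.trans_lt ht
  set m := a * x + (1 - a) * y with hm
  have hm0 : 0 ≤ m := add_nonneg (mul_nonneg ha.le hx0) (mul_nonneg (sub_nonneg.2 h1) hy0)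
  have hm1 : m ≤ 1 := by nlinarith
  rcases le_or_gt m a with hma | hma
  · have hc : a * (m / a) = m := mul_div_cancel₀ m ha.ne'
    refine ⟨(m / a, 0), ⟨div_nonneg hm0 ha.le, (div_le_one ha).2 hma⟩, by simp, by simp,
      by simp [hc], ?_⟩
    refine le_of_mul_le_mul_left ?_ ha
    calc a * (b * (m / a) + (1 - b) * 0) = b * m := by linear_combination b * hc
      _ ≤ a * (b * x + (1 - b) * y) := by
        rw [hm]
        nlinarith [mul_nonneg hy0 (sub_nonneg.2 ht.le)]
  · have ha1 : 0 < 1 - a := by linarith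
    have hd : (1 - a) * ((m - a) / (1 - a)) = m - a := mul_div_cancel₀ _ ha1.ne'
    refine ⟨(1, (m - a) / (1 - a)), by simp,
      ⟨div_nonneg (by linarith) ha1.le, (div_le_one ha1).2 (by linarith)⟩, by simp,
      by linear_combination hd, ?_⟩
    refine le_of_mul_le_mul_left ?_ ha1
    calc (1 - a) * (b * 1 + (1 - b) * ((m - a) / (1 - a)))
        = (1 - a) * b + (1 - b) * (m - a) := by linear_combination (1 - b) * hd
      _ ≤ (1 - a) * (b * x + (1 - b) * y) := by
        rw [hm]
        nlinarith [mul_nonneg (sub_nonneg.2 hx1) (sub_nonneg.2 ht.le)]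

/-- Every Equal Opportunity policy with positive recall is weakly Pareto dominated (w.r.t.
recall and precision) by an Equal Opportunity policy satisfying
`(1 − π'^i_{X1})·π'^i_{X0} = 0` at every stage and group. -/
theorem stmt8 {𝒳 : Type*} [Fintype 𝒳] [Nonempty 𝒳] {k : ℕ}
    (q u : 𝒳 → ℝ) (τ : 𝒳 → Fin k → ℝ × ℝ)
    (hq : ∀ x, 0 < q x) (hu : ∀ x, 0 < u x) (hτ : MinEff τ)
    (π : 𝒳 → Fin k → ℝ × ℝ) (hπ : IsPolicy π)
    (r : ℝ) (hEO : ∀ x, MX τ π x = r) (hr : 0 < r) :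
    ∃ (π' : 𝒳 → Fin k → ℝ × ℝ) (r' : ℝ), IsPolicy π' ∧ (∀ x, MX τ π' x = r') ∧
      (∀ x i, (1 - (π' x i).1) * (π' x i).2 = 0) ∧
      r ≤ r' ∧ prec q u τ π ≤ prec q u τ π' := by
  choose π' h₁ h₀ hext hM hN using fun x i =>
    exists_extremal_rule (hτ x i).1 (hτ x i).2.1 (hτ x i).2.2 (hπ x i).1 (hπ x i).2
  have hMX : ∀ x, MX τ π' x = MX τ π x := fun x => Finset.prod_congr rfl fun i _ => hM x i
  have hN0 : ∀ x i, 0 ≤ Nval (τ x i) (π' x i) := fun x i =>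
    Nval_nonneg (hτ x i).2.1 ((hτ x i).1.le.trans (hτ x i).2.2) (h₁ x i).1 (h₀ x i).1
  have hNX0 : ∀ x, 0 ≤ NX τ π' x := fun x => Finset.prod_nonneg fun i _ => hN0 x i
  have hNX : ∀ x, NX τ π' x ≤ NX τ π x := fun x =>
    Finset.prod_le_prod (fun i _ => hN0 x i) fun i _ => hN x i
  refine ⟨π', r, fun x i => ⟨h₁ x i, h₀ x i⟩, fun x => (hMX x).trans (hEO x), hext, le_rfl, ?_⟩
  have hpos : 0 < ∑ x, q x * MX τ π x :=
    Finset.sum_pos (fun x _ => mul_pos (hq x) (hEO x ▸ hr)) Finset.univ_nonempty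
  have hneg : 0 ≤ ∑ x, u x * NX τ π' x :=
    Finset.sum_nonneg fun x _ => mul_nonneg (hu x).le (hNX0 x)
  simp only [prec, hMX]
  refine div_le_div_of_nonneg_left hpos.le (add_pos_of_pos_of_nonneg hpos hneg) ?_
  gcongr with x
  · exact (hu x).le
  · exact hNX x
end

section
/- Consider a k-stage screening process with minimally effective tests and let π be any Equal Opportunity policy with recall(π) > 0. Then there exists an Equal Opportunity policy π' satisfying (1 − π'^i_{X1})·π'^i_{X0} = 0 for every X ∈ 𝒳 and i ∈ {1,…,k}, such that for each group X ∈ 𝒳 there is at most one stage i with π'^i_{X1} < 1, and with recall(π') ≥ recall(π) and precision(π') ≥ precision(π). -/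
open Finset

/-- Among the stage policies with a given true positive rate, one on the efficient frontier
has the smallest false positive rate. -/
lemma exists_frontier_stage {t p : ℝ × ℝ} (ht : t.2 < t.1) (ht0 : 0 ≤ t.2) (ht1 : t.1 ≤ 1)
    (hp1 : p.1 ∈ Set.Icc (0 : ℝ) 1) (hp2 : p.2 ∈ Set.Icc (0 : ℝ) 1) :
    ∃ p' : ℝ × ℝ, p'.1 ∈ Set.Icc (0 : ℝ) 1 ∧ p'.2 ∈ Set.Icc (0 : ℝ) 1 ∧
      (1 - p'.1) * p'.2 = 0 ∧ Mval t p' = Mval t p ∧ Nval t p' ≤ Nval t p := by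
  obtain ⟨a, b⟩ := t
  obtain ⟨x, y⟩ := p
  obtain ⟨hx0, hx1⟩ := hp1
  obtain ⟨hy0, hy1⟩ := hp2
  simp only [Mval, Nval] at *
  have ha : 0 < a := by linarith
  by_cases h : a * x + (1 - a) * y ≤ a
  · refine ⟨((a * x + (1 - a) * y) / a, 0), ⟨?_, ?_⟩, by simp, by simp, ?_, ?_⟩
    · have := mul_nonneg (sub_nonneg.2 ht1) hy0
      positivity
    · exact (div_le_one ha).2 h
    · field_simp
      ring
    · have key : b * ((a * x + (1 - a) * y) / a) = b * (a * x + (1 - a) * y) / a := by ring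
      simp only [mul_zero, add_zero]
      rw [key, div_le_iff₀ ha]
      nlinarith [mul_nonneg (sub_nonneg.2 ht.le) hy0]
  · have ha1 : 0 < 1 - a := by
      rcases ht1.lt_or_eq with h' | rfl
      · linarith
      · exact absurd (by linarith) h
    push Not at h
    refine ⟨(1, (a * x + (1 - a) * y - a) / (1 - a)), by simp, ⟨?_, ?_⟩, by simp, ?_, ?_⟩
    · exact div_nonneg (by linarith) ha1.le
    · rw [div_le_one ha1]
      nlinarith
    · field_simp
      ring
    · have key : (1 - b) * ((a * x + (1 - a) * y - a) / (1 - a))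
          = (1 - b) * (a * x + (1 - a) * y - a) / (1 - a) := by ring
      simp only [mul_one]
      rw [key, ← le_sub_iff_add_le', div_le_iff₀ ha1]
      nlinarith [mul_nonneg (sub_nonneg.2 ht.le) (sub_nonneg.2 hx1)]

lemma Mval_eq_mul_of_frontier {t : ℝ × ℝ} {a b : ℝ} (h : (1 - a) * b = 0) :
    Mval t (a, b) = a * Mval t (1, b) := by
  simp only [Mval]
  linear_combination (1 - t.1) * h

lemma Nval_eq_mul_of_frontier {t : ℝ × ℝ} {a b : ℝ} (h : (1 - a) * b = 0) :
    Nval t (a, b) = a * Nval t (1, b) := by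
  simp only [Nval]
  linear_combination (1 - t.2) * h

lemma Nval_nonneg_s10 {t p : ℝ × ℝ} (ht0 : 0 ≤ t.2) (ht1 : t.2 ≤ 1)
    (hp1 : 0 ≤ p.1) (hp2 : 0 ≤ p.2) : 0 ≤ Nval t p :=
  add_nonneg (mul_nonneg ht0 hp1) (mul_nonneg (sub_nonneg.2 ht1) hp2)

/-- The random rejections of a pipeline on the efficient frontier can all be moved into a
single stage. -/
lemma exists_concentrated_pipeline {ι : Type*} [Fintype ι] {t p : ι → ℝ × ℝ}
    (hp1 : ∀ i, (p i).1 ∈ Set.Icc (0 : ℝ) 1) (hp2 : ∀ i, (p i).2 ∈ Set.Icc (0 : ℝ) 1)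
    (hp : ∀ i, (1 - (p i).1) * (p i).2 = 0) :
    ∃ p' : ι → ℝ × ℝ, (∀ i, (p' i).1 ∈ Set.Icc (0 : ℝ) 1 ∧ (p' i).2 ∈ Set.Icc (0 : ℝ) 1) ∧
      (∀ i, (1 - (p' i).1) * (p' i).2 = 0) ∧
      (∀ i j, (p' i).1 < 1 → (p' j).1 < 1 → i = j) ∧
      ∏ i, Mval (t i) (p' i) = ∏ i, Mval (t i) (p i) ∧
      ∏ i, Nval (t i) (p' i) = ∏ i, Nval (t i) (p i) := by
  classical
  by_cases h : ∃ j, (p j).1 < 1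
  · obtain ⟨j, hj⟩ := h
    have hj0 : (p j).2 = 0 := (mul_eq_zero.1 (hp j)).resolve_left (by linarith)
    set c : ι → ℝ := fun i => if i = j then ∏ l, (p l).1 else 1 with hc
    have hcprod : ∏ i, c i = ∏ i, (p i).1 := by simp [hc]
    have hfront : ∀ i, (1 - c i) * (p i).2 = 0 := by
      intro i
      by_cases hij : i = j
      · simp [hij, hj0]
      · simp [hc, hij]
    refine ⟨fun i => (c i, (p i).2), fun i => ⟨?_, hp2 i⟩, hfront, ?_, ?_, ?_⟩
    · by_cases hij : i = j
      · simp only [hc, hij, if_true]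
        exact ⟨prod_nonneg fun l _ => (hp1 l).1,
          prod_le_one (fun l _ => (hp1 l).1) fun l _ => (hp1 l).2⟩
      · simp [hc, hij]
    · have : ∀ i, c i < 1 → i = j := by
        intro i hi
        by_contra hij
        simp [hc, hij] at hi
      intro i l hi hl
      rw [this i hi, this l hl]
    · rw [prod_congr rfl fun i _ => Mval_eq_mul_of_frontier (hfront i),
        prod_congr rfl fun i _ => Mval_eq_mul_of_frontier (hp i),
        prod_mul_distrib, prod_mul_distrib, hcprod]
    · rw [prod_congr rfl fun i _ => Nval_eq_mul_of_frontier (hfront i),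
        prod_congr rfl fun i _ => Nval_eq_mul_of_frontier (hp i),
        prod_mul_distrib, prod_mul_distrib, hcprod]
  · exact ⟨p, fun i => ⟨hp1 i, hp2 i⟩, hp, fun i j hi => absurd ⟨i, hi⟩ h, rfl, rfl⟩

/-- Every Equal Opportunity policy with positive recall is weakly Pareto dominated by an
Equal Opportunity policy satisfying `(1 − π'^i_{X1})·π'^i_{X0} = 0` everywhere and such that
for each group there is at most one stage with `π'^i_{X1} < 1`. -/
theorem stmt10 {𝒳 : Type*} [Fintype 𝒳] [Nonempty 𝒳] {k : ℕ}
    (q u : 𝒳 → ℝ) (τ : 𝒳 → Fin k → ℝ × ℝ)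
    (hq : ∀ x, 0 < q x) (hu : ∀ x, 0 < u x) (hτ : MinEff τ)
    (π : 𝒳 → Fin k → ℝ × ℝ) (hπ : IsPolicy π)
    (r : ℝ) (hEO : ∀ x, MX τ π x = r) (hr : 0 < r) :
    ∃ (π' : 𝒳 → Fin k → ℝ × ℝ) (r' : ℝ), IsPolicy π' ∧ (∀ x, MX τ π' x = r') ∧
      (∀ x i, (1 - (π' x i).1) * (π' x i).2 = 0) ∧
      (∀ x i j, (π' x i).1 < 1 → (π' x j).1 < 1 → i = j) ∧
      r ≤ r' ∧ prec q u τ π ≤ prec q u τ π' := by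
  have hb : ∀ x i, (τ x i).2 ≤ 1 := fun x i => (hτ x i).1.le.trans (hτ x i).2.2
  choose p hp1 hp2 hp hM hN using fun x i =>
    exists_frontier_stage (hτ x i).1 (hτ x i).2.1 (hτ x i).2.2 (hπ x i).1 (hπ x i).2
  choose p' hp' hfront huniq hM' hN' using fun x =>
    exists_concentrated_pipeline (t := τ x) (hp1 x) (hp2 x) (hp x)
  have hMX : ∀ x, MX τ p' x = r := by
    intro x
    rw [← hEO x]
    exact (hM' x).trans (prod_congr rfl fun i _ => hM x i)
  have hNX : ∀ x, NX τ p' x ≤ NX τ π x := by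
    intro x
    refine (hN' x).le.trans (prod_le_prod (fun i _ => ?_) fun i _ => hN x i)
    exact Nval_nonneg_s10 (hτ x i).2.1 (hb x i) (hp1 x i).1 (hp2 x i).1
  have hNX0 : ∀ x, 0 ≤ NX τ p' x := fun x => prod_nonneg fun i _ =>
    Nval_nonneg_s10 (hτ x i).2.1 (hb x i) (hp' x i).1.1 (hp' x i).2.1
  refine ⟨p', r, hp', hMX, hfront, huniq, le_rfl, ?_⟩
  have hpos : 0 < ∑ x, q x * r := sum_pos (fun x _ => mul_pos (hq x) hr) univ_nonempty
  have hneg : 0 ≤ ∑ x, u x * NX τ p' x := sum_nonneg fun x _ => mul_nonneg (hu x).le (hNX0 x)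
  simp only [prec, hMX, hEO]
  refine div_le_div_of_nonneg_left hpos.le (by linarith) ?_
  gcongr with x
  · exact (hu x).le
  · exact hNX x
end

section
/- For every γ ∈ (0,1), every ε > 0, and every k ≥ 1, there exists a k-stage screening process with minimally effective tests whose weights satisfy Σ_{X∈𝒳} q_X = γ, together with an Equal Opportunity policy π₁ with positive precision denominator, such that for every policy π₂ satisfying Equalized Odds with positive precision denominator, precision(π₁)/precision(π₂) ≥ 1/γ − ε. (The precision gap between the best Equal Opportunity policy and the best Equalized Odds policy can be as large as 1/‖q‖₁ − ε.) -/
open Finset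

/-- If the false positive rate is at least a fraction `c` of the true positive rate at each stage,
then the same holds for the pipeline with the fraction `c ^ k`. -/
lemma pow_mul_MX_le_NX {𝒳 : Type*} {k : ℕ} {τ π : 𝒳 → Fin k → ℝ × ℝ} {x : 𝒳} {c : ℝ}
    (hc : 0 ≤ c) (hM : ∀ i, 0 ≤ Mval (τ x i) (π x i))
    (h : ∀ i, c * Mval (τ x i) (π x i) ≤ Nval (τ x i) (π x i)) :
    c ^ k * MX τ π x ≤ NX τ π x := by
  have := Finset.prod_le_prod (s := univ) (fun i _ => mul_nonneg hc (hM i)) fun i _ => h i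
  simpa [MX, NX, Finset.prod_mul_distrib] using this

/-- If the true positive rate is at least a fraction `c` of the false positive rate at each stage,
then the same holds for the pipeline with the fraction `c ^ k`. -/
lemma pow_mul_NX_le_MX {𝒳 : Type*} {k : ℕ} {τ π : 𝒳 → Fin k → ℝ × ℝ} {x : 𝒳} {c : ℝ}
    (hc : 0 ≤ c) (hN : ∀ i, 0 ≤ Nval (τ x i) (π x i))
    (h : ∀ i, c * Nval (τ x i) (π x i) ≤ Mval (τ x i) (π x i)) :
    c ^ k * NX τ π x ≤ MX τ π x := by
  have := Finset.prod_le_prod (s := univ) (fun i _ => mul_nonneg hc (hN i)) fun i _ => h i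
  simpa [MX, NX, Finset.prod_mul_distrib] using this

/-- For every `γ ∈ (0,1)`, `ε > 0` and `k ≥ 1` there is a `k`-stage screening process with
minimally effective tests and total qualified weight `γ`, together with an Equal Opportunity
policy `π₁`, such that every Equalized Odds policy `π₂` (with positive precision denominator)
satisfies `precision(π₁)/precision(π₂) ≥ 1/γ − ε`. -/
theorem stmt15 (γ ε : ℝ) (hγ : γ ∈ Set.Ioo (0:ℝ) 1) (hε : 0 < ε) (k : ℕ) (hk : 1 ≤ k) :
    ∃ (n : ℕ) (_ : 0 < n) (q u : Fin n → ℝ) (τ : Fin n → Fin k → ℝ × ℝ),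
      (∀ x, 0 < q x) ∧ (∀ x, 0 < u x) ∧ MinEff τ ∧ (∑ x, q x) = γ ∧
      ∃ π₁ : Fin n → Fin k → ℝ × ℝ, IsPolicy π₁ ∧
        (∀ x y, MX τ π₁ x = MX τ π₁ y) ∧
        (0 < (∑ x, q x * MX τ π₁ x) + ∑ x, u x * NX τ π₁ x) ∧
        ∀ π₂ : Fin n → Fin k → ℝ × ℝ, IsPolicy π₂ →
          (∀ x y, MX τ π₂ x = MX τ π₂ y) → (∀ x y, NX τ π₂ x = NX τ π₂ y) →
          0 < (∑ x, q x * MX τ π₂ x) + ∑ x, u x * NX τ π₂ x →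
          prec q u τ π₁ / prec q u τ π₂ ≥ 1 / γ - ε := by
  obtain ⟨hγ0, hγ1⟩ := hγ
  have hk0 : k ≠ 0 := by omega
  set τ : Fin 2 → Fin k → ℝ × ℝ := ![fun _ => (2 / 3, 1 / 3), fun _ => (1, 0)] with hτ
  set π₁ : Fin 2 → Fin k → ℝ × ℝ := ![fun _ => (1, 1), fun _ => (1, 0)] with hπ₁
  have hM0 : MX τ π₁ 0 = 1 := Finset.prod_eq_one fun i _ => by norm_num [Mval, hτ, hπ₁]
  have hM1 : MX τ π₁ 1 = 1 := Finset.prod_eq_one fun i _ => by norm_num [Mval, hτ, hπ₁]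
  have hN0 : NX τ π₁ 0 = 1 := Finset.prod_eq_one fun i _ => by norm_num [Nval, hτ, hπ₁]
  have hN1 : NX τ π₁ 1 = 0 := by simp [NX, Nval, hτ, hπ₁, hk0]
  refine ⟨2, two_pos, fun _ => γ / 2, ![1, 2 ^ k * (2 / γ)], τ, fun _ => by positivity, ?_, ?_,
    by simp; ring, π₁, ?_, ?_, ?_, ?_⟩
  · simp only [Fin.forall_fin_two, Matrix.cons_val_zero, Matrix.cons_val_one]
    exact ⟨one_pos, by positivity⟩
  · simp only [MinEff, Fin.forall_fin_two, hτ, Matrix.cons_val_zero, Matrix.cons_val_one]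
    norm_num
  · simp only [IsPolicy, Fin.forall_fin_two, hπ₁, Matrix.cons_val_zero, Matrix.cons_val_one]
    norm_num
  · simp [Fin.forall_fin_two, hM0, hM1]
  · simp only [Fin.sum_univ_two, hM0, hM1, hN0, hN1, Matrix.cons_val_zero, Matrix.cons_val_one]
    linarith
  intro π₂ hπ₂ hM hN hpos
  have hle : (1 / 2 : ℝ) ^ k * MX τ π₂ 0 ≤ NX τ π₂ 0 := by
    refine pow_mul_MX_le_NX (by norm_num) (fun i => ?_) fun i => ?_ <;>
    · obtain ⟨⟨h1, -⟩, h2, -⟩ := hπ₂ 0 i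
      simp only [Mval, Nval, hτ, Matrix.cons_val_zero]
      linarith
  have hge : (1 / 2 : ℝ) ^ k * NX τ π₂ 0 ≤ MX τ π₂ 0 := by
    refine pow_mul_NX_le_MX (by norm_num) (fun i => ?_) fun i => ?_ <;>
    · obtain ⟨⟨h1, -⟩, h2, -⟩ := hπ₂ 0 i
      simp only [Mval, Nval, hτ, Matrix.cons_val_zero]
      linarith
  simp only [prec, Fin.sum_univ_two, hM0, hM1, hN0, hN1, hM 1 0, hN 1 0, Matrix.cons_val_zero,
    Matrix.cons_val_one] at hpos ⊢
  set m := MX τ π₂ 0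
  set n := NX τ π₂ 0
  have hP : (0 : ℝ) < 2 ^ k := by positivity
  rw [one_div, inv_pow, inv_mul_le_iff₀ hP] at hle hge
  set P : ℝ := 2 ^ k
  have hm : 0 < m := by
    by_contra! hm
    have hn : n ≤ 0 := hge.trans (mul_nonpos_of_nonneg_of_nonpos hP.le hm)
    have hn' : P * (2 / γ) * n ≤ 0 := mul_nonpos_of_nonneg_of_nonpos (by positivity) hn
    nlinarith
  have hn : 2 / γ * m ≤ P * (2 / γ) * n := by
    calc 2 / γ * m ≤ 2 / γ * (P * n) := by gcongr
      _ = P * (2 / γ) * n := by ring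
  have hn0 : 0 < n := pos_of_mul_pos_right (hm.trans_le hle) hP.le
  have key : 1 / γ * (γ + 1) * m ≤ γ * m + (n + P * (2 / γ) * n) := by
    have h : 1 / γ * (γ + 1) ≤ γ + 2 / γ := by
      field_simp
      nlinarith
    nlinarith [mul_le_mul_of_nonneg_right h hm.le]
  calc 1 / γ - ε ≤ 1 / γ := by linarith
    _ ≤ (γ * m + (n + P * (2 / γ) * n)) / ((γ + 1) * m) := by
      rw [le_div_iff₀ (by positivity)]
      linarith
    _ = _ := by
      field_simp
      ring
end

section
/- Let q, u > 0 and let M, N, ε be reals with 0 ≤ N < M and 0 < ε ≤ N. Then qM/(qM + uN) < q(M−ε)/(q(M−ε) + u(N−ε)). (Consequently, subtracting a common positive constant from the common true-positive and false-positive promotion rates of a nontrivial Equalized Odds policy strictly increases its precision, so any non-trivial precision-optimal Equalized Odds policy has min(π_{A1}, π_{A0}, π_{B1}, π_{B0}) = 0.) -/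
/-- For `q, u > 0`, `0 ≤ N < M` and `0 < ε ≤ N`, subtracting `ε` from both promotion rates
strictly increases the precision: `qM/(qM + uN) < q(M−ε)/(q(M−ε) + u(N−ε))`. -/
theorem stmt16 (q u M N ε : ℝ) (hq : 0 < q) (hu : 0 < u)
    (hN : 0 ≤ N) (hNM : N < M) (hε : 0 < ε) (hεN : ε ≤ N) :
    q * M / (q * M + u * N) < q * (M - ε) / (q * (M - ε) + u * (N - ε)) := by
  have hM : 0 < q * M := mul_pos hq (by linarith)
  have hMε : 0 < q * (M - ε) := mul_pos hq (by linarith)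
  have huN : 0 ≤ u * N := mul_nonneg hu.le hN
  have huNε : 0 ≤ u * (N - ε) := mul_nonneg hu.le (by linarith)
  have hgap : 0 < q * u * (ε * (M - N)) :=
    mul_pos (mul_pos hq hu) (mul_pos hε (sub_pos.mpr hNM))
  rw [div_lt_div_iff₀ (by linarith) (by linarith)]
  linarith
end
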